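/- Let C be a nontrivial root class of groups that is closed under taking quotient groups. Let G = ⟨A * B; H = K, φ⟩ be the free product of nilpotent C-groups A and B with the subgroups H ≤ A and K ≤ B amalgamated according to an isomorphism φ : H → K. Suppose that A and B possess central series 1 = A₀ ≤ A₁ ≤ … ≤ Aₙ = A and 1 = B₀ ≤ B₁ ≤ … ≤ Bₙ = B of the same length n such that φ(Aᵢ ∩ H) = Bᵢ ∩ K for every i ∈ {1, 2, …, n}. Then there exists a homomorphism of G onto a solvable C-group which is injective on A and on B. In particular, G is residually a CS-group, where CS is the class of all solvable C-groups. -/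

import Mathlib

universe u

open scoped commutatorElement

/-- A class of groups `C` is closed under isomorphism. -/
def IsoClosed (C : ∀ (G : Type u) [Group G], Prop) : Prop :=
  ∀ (G H : Type u) [Group G] [Group H], (G ≃* H) → C G → C H

/-- A class of groups `C` is closed under taking subgroups. -/
def SubgroupClosed (C : ∀ (G : Type u) [Group G], Prop) : Prop :=
  ∀ (G : Type u) [Group G] (H : Subgroup G), C G → C H

/-- A class of groups `C` is closed under extensions. -/
def ExtensionClosed (C : ∀ (G : Type u) [Group G], Prop) : Prop :=
  ∀ (G : Type u) [Group G] (N : Subgroup G) [N.Normal], C N → C (G ⧸ N) → C G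

/-- A class of groups `C` is closed under direct products of two of its members. -/
def ProdClosed (C : ∀ (G : Type u) [Group G], Prop) : Prop :=
  ∀ (X Y : Type u) [Group X] [Group Y], C X → C Y → C (X × Y)

/-- For all `X, Y ∈ C`, the unrestricted Cartesian product `∏_{y ∈ Y} X` belongs to `C`. -/
def PiClosed (C : ∀ (G : Type u) [Group G], Prop) : Prop :=
  ∀ (X Y : Type u) [Group X] [Group Y], C X → C Y → C (Y → X)

/-- The Gruenberg condition: for every group `X` and every subnormal chain `Z ⊴ Y ⊴ X`
with factors `Y/Z` and `X/Y` in `C`, there is a normal subgroup `T` of `X` with `T ≤ Z`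
and `X/T ∈ C`. -/
def Gruenberg (C : ∀ (G : Type u) [Group G], Prop) : Prop :=
  ∀ (X : Type u) [Group X] (Y : Subgroup X) [Y.Normal] (Z : Subgroup X)
    [(Z.subgroupOf Y).Normal], Z ≤ Y →
    C (Y ⧸ Z.subgroupOf Y) → C (X ⧸ Y) →
    ∃ (T : Subgroup X) (hT : T.Normal), T ≤ Z ∧ (letI := hT; C (X ⧸ T))

/-- A root class of groups. -/
def RootClass (C : ∀ (G : Type u) [Group G], Prop) : Prop :=
  IsoClosed C ∧ SubgroupClosed C ∧ ProdClosed C ∧ Gruenberg C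

/-- The action of `Y` on the unrestricted direct power `Y → X` by translating coordinates. -/
def wreathAut (X Y : Type u) [Group X] [Group Y] : Y →* MulAut (Y → X) where
  toFun g :=
    { toFun := fun b y => b (g⁻¹ * y)
      invFun := fun b y => b (g * y)
      left_inv := fun b => funext fun y => by simp [← mul_assoc]
      right_inv := fun b => funext fun y => by simp [← mul_assoc]
      map_mul' := fun b₁ b₂ => rfl }
  map_one' := by ext b y; simp
  map_mul' := fun g₁ g₂ => by ext b y; simp [mul_assoc]

/-- The complete (Cartesian) wreath product `X Wr Y`: the semidirect product of the
unrestricted direct power `Y → X` by `Y` acting by translation of coordinates. -/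
abbrev WreathProduct (X Y : Type u) [Group X] [Group Y] : Type u :=
  SemidirectProduct (Y → X) Y (wreathAut X Y)

/-- A class of groups `C` is closed under complete (Cartesian) wreath products. -/
def WreathClosed (C : ∀ (G : Type u) [Group G], Prop) : Prop :=
  ∀ (X Y : Type u) [Group X] [Group Y], C X → C Y → C (WreathProduct X Y)

instance boolCondGroup {A B : Type u} [Group A] [Group B] : ∀ i : Bool, Group (cond i A B)
  | true => ‹Group A›
  | false => ‹Group B›

/-- The two inclusions of the amalgamated subgroup, `H ↪ A` and `H ≃ K ↪ B`. -/
def amalgMaps {A B : Type u} [Group A] [Group B] (H : Subgroup A) (K : Subgroup B)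
    (φ : H ≃* K) : ∀ i : Bool, (H : Type u) →* cond i A B
  | true => H.subtype
  | false => K.subtype.comp φ.toMonoidHom

/-- The generalized free product (amalgamated free product) `⟨A * B; H = K, φ⟩`,
realized as the pushout of the inclusions `H ↪ A` and `H → K ↪ B`. -/
def AmalgamatedProduct (A B : Type u) [Group A] [Group B] (H : Subgroup A) (K : Subgroup B)
    (φ : H ≃* K) : Type u :=
  Monoid.PushoutI (amalgMaps H K φ)

instance (A B : Type u) [Group A] [Group B] (H : Subgroup A) (K : Subgroup B) (φ : H ≃* K) :
    Group (AmalgamatedProduct A B H K φ) := by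
  delta AmalgamatedProduct; infer_instance

/-- The canonical homomorphism of `A` into the amalgamated product. -/
def amalgInl {A B : Type u} [Group A] [Group B] (H : Subgroup A) (K : Subgroup B)
    (φ : H ≃* K) : A →* AmalgamatedProduct A B H K φ :=
  Monoid.PushoutI.of (φ := amalgMaps H K φ) true

/-- The canonical homomorphism of `B` into the amalgamated product. -/
def amalgInr {A B : Type u} [Group A] [Group B] (H : Subgroup A) (K : Subgroup B)
    (φ : H ≃* K) : B →* AmalgamatedProduct A B H K φ :=
  Monoid.PushoutI.of (φ := amalgMaps H K φ) false

/-- A class of groups `C` is closed under taking quotient groups. -/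
def QuotClosed (C : ∀ (G : Type u) [Group G], Prop) : Prop :=
  ∀ (G : Type u) [Group G] (N : Subgroup G) [N.Normal], C G → C (G ⧸ N)

open SemidirectProduct Monoid

theorem wreathAut_apply_apply {X Y : Type u} [Group X] [Group Y] (g y : Y) (b : Y → X) :
    wreathAut X Y g b y = b (g⁻¹ * y) := rfl

section Classes

variable {C : ∀ (G : Type u) [Group G], Prop}

theorem RootClass.wreathClosed (hC : RootClass C) : WreathClosed C := by
  obtain ⟨hiso, -, -, hG⟩ := hC
  intro X Y _ _ hX hY
  let base : Subgroup (WreathProduct X Y) := (rightHom : WreathProduct X Y →* Y).ker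
  let ev : base →* X :=
    { toFun := fun g => g.1.left 1
      map_one' := rfl
      map_mul' := fun g h => by
        have hg : g.1.right = 1 := g.2
        simp [hg] }
  have hev : Function.Surjective ev := fun x =>
    ⟨⟨inl fun _ => x, by simp [base, MonoidHom.mem_ker]⟩, rfl⟩
  let Z : Subgroup (WreathProduct X Y) := ev.ker.map base.subtype
  have hZ : Z.subgroupOf base = ev.ker :=
    Subgroup.comap_map_eq_self_of_injective base.subtype_injective _
  have : (Z.subgroupOf base).Normal := by rw [hZ]; infer_instance
  obtain ⟨T, hT, hTZ, hCT⟩ := hG (WreathProduct X Y) base Z (Subgroup.map_subtype_le _)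
    (hiso _ _ ((QuotientGroup.quotientMulEquivOfEq hZ).trans
      (QuotientGroup.quotientKerEquivOfSurjective ev hev)).symm hX)
    (hiso _ _ (QuotientGroup.quotientKerEquivOfSurjective _ rightHom_surjective).symm hY)
  have hTbot : T = ⊥ := by
    rw [eq_bot_iff]
    intro t ht
    have key : ∀ z ∈ T, z.right = 1 ∧ z.left 1 = 1 := by
      intro z hz
      obtain ⟨z, hz', rfl⟩ := hTZ hz
      exact ⟨z.2, hz'⟩
    rw [Subgroup.mem_bot]
    ext y
    · have h := (key _ (hT.conj_mem t ht (inr y⁻¹))).2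
      simpa [-map_inv, wreathAut_apply_apply, (key t ht).1] using h
    · exact (key t ht).1
  subst hTbot
  exact hiso _ _ QuotientGroup.quotientBot hCT

theorem isSolvable_pi (X Y : Type*) [Group X] [hX : Group.IsSolvable X] :
    Group.IsSolvable (Y → X) := by
  obtain ⟨n, hn⟩ := hX.solvable
  refine ⟨n, ?_⟩
  rw [eq_bot_iff]
  intro b hb
  rw [Subgroup.mem_bot]
  funext y
  have h := map_derivedSeries_le_derivedSeries (Pi.evalMonoidHom (fun _ : Y => X) y) n
    (Subgroup.mem_map_of_mem _ hb)
  rw [hn] at h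
  exact h

theorem isSolvable_wreathProduct (X Y : Type u) [Group X] [Group Y] [Group.IsSolvable X]
    [Group.IsSolvable Y] : Group.IsSolvable (WreathProduct X Y) :=
  have := isSolvable_pi X Y
  Group.isSolvable_of_ker_le_range (inl : (Y → X) →* WreathProduct X Y) rightHom
    range_inl_eq_ker_rightHom.ge

end Classes

section Cocycles

theorem exists_orbit_section {A S : Type*} [Group A] [Group S] (α : A →* S) :
    ∃ (r : S → S) (τ : S → A), (∀ a s, r (α a * s) = r s) ∧ ∀ s, α (τ s) * r s = s := by
  let r : S → S := fun s => (Quotient.mk (QuotientGroup.rightRel α.range) s).out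
  have h : ∀ s, ∃ a, α a = s * (r s)⁻¹ := fun s =>
    QuotientGroup.rightRel_apply.1 (Quotient.mk_out (s := QuotientGroup.rightRel α.range) s)
  choose τ hτ using h
  refine ⟨r, τ, fun a s => congrArg Quotient.out (Quotient.sound ?_), fun s => by simp [hτ]⟩
  refine QuotientGroup.rightRel_apply.2 ⟨a⁻¹, ?_⟩
  simp

/-- A homomorphism on `ker α` invariant under conjugation extends to a cocycle with
coefficients in the functions on the target of `α`. -/
theorem exists_cocycle_extending {A S D : Type*} [Group A] [Group S] [Group D] (α : A →* S)
    (p : α.ker →* D) (hp : ∀ (a : A) (d e : α.ker), (e : A) = a⁻¹ * d * a → p e = p d) :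
    ∃ c : A → S → D, (∀ a b s, c (a * b) s = c a (α b * s) * c b s) ∧
      ∀ (d : α.ker) s, c d s = p d := by
  obtain ⟨r, τ, hr, hτ⟩ := exists_orbit_section α
  have hτ' : ∀ s, α (τ s) = s * (r s)⁻¹ := fun s => eq_mul_inv_of_mul_eq (hτ s)
  have hker : ∀ a s, (τ (α a * s))⁻¹ * a * τ s ∈ α.ker := fun a s => by
    simp [MonoidHom.mem_ker, hτ', hr, mul_assoc]
  refine ⟨fun a s => p ⟨_, hker a s⟩, fun a b s => ?_, fun d s => hp (τ s) _ _ ?_⟩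
  · rw [← map_mul]
    refine congrArg p (Subtype.ext ?_)
    simp [mul_assoc]
  · have hd : α d = 1 := d.2
    simp [hd]

/-- A cocycle that vanishes on `ker γ` is a coboundary. -/
theorem exists_coboundary {H S D : Type*} [Group H] [Group S] [Group D] (γ : H →* S)
    (δ : H → S → D) (hδ : ∀ g h s, δ (g * h) s = δ g (γ h * s) * δ h s)
    (hker : ∀ h s, γ h = 1 → δ h s = 1) :
    ∃ w : S → D, ∀ h s, w (γ h * s) = δ h s * w s := by
  obtain ⟨r, η, hr, hη⟩ := exists_orbit_section γ
  have hη' : ∀ s, γ (η s) = s * (r s)⁻¹ := fun s => eq_mul_inv_of_mul_eq (hη s)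
  refine ⟨fun s => δ (η s) (r s), fun h s => ?_⟩
  have hd : γ ((h * η s)⁻¹ * η (γ h * s)) = 1 := by simp [hη', hr, mul_assoc]
  have h1 := hδ (h * η s) ((h * η s)⁻¹ * η (γ h * s)) (r s)
  rw [hker _ _ hd, hd, one_mul, mul_one, mul_inv_cancel_left, hδ, hη] at h1
  simpa only [hr] using h1

/-- The homomorphism to the wreath product determined by a cocycle. -/
def wreathHomOfCocycle {A : Type*} {S D : Type u} [Group A] [Group S] [Group D] (α : A →* S)
    (c : A → S → D) (hc : ∀ a b s, c (a * b) s = c a (α b * s) * c b s) :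
    A →* WreathProduct D S :=
  MonoidHom.mk' (fun a => ⟨fun s => c a ((α a)⁻¹ * s), α a⟩) fun a b => by
    ext s
    · simp [wreathAut_apply_apply, hc, mul_assoc]
    · simp

theorem wreathHomOfCocycle_ker {A : Type*} {S D : Type u} [Group A] [Group S] [Group D]
    (α : A →* S) (c : A → S → D) (hc : ∀ a b s, c (a * b) s = c a (α b * s) * c b s) (a : A) :
    wreathHomOfCocycle α c hc a = 1 ↔ α a = 1 ∧ ∀ s, c a s = 1 := by
  rw [SemidirectProduct.ext_iff, and_comm]
  refine and_congr_right fun (ha : α a = 1) => ?_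
  simp [wreathHomOfCocycle, funext_iff, ha]

/-- Compatible homomorphisms to `S`, together with compatible central homomorphisms of their
kernels to `D`, combine into compatible homomorphisms to `D Wr S`. -/
theorem exists_compatible_wreath_homs {A B H : Type*} {S D : Type u} [Group A] [Group B]
    [Group H] [Group S] [CommGroup D] (i : H →* A) (j : H →* B) (α : A →* S) (β : B →* S)
    (hαβ : ∀ h, α (i h) = β (j h)) (p : α.ker →* D) (q : β.ker →* D)
    (hp : ∀ (a : A) (d e : α.ker), (e : A) = a⁻¹ * d * a → p e = p d)
    (hq : ∀ (b : B) (d e : β.ker), (e : B) = b⁻¹ * d * b → q e = q d)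
    (hpq : ∀ (h : H) (hi : i h ∈ α.ker) (hj : j h ∈ β.ker), p ⟨i h, hi⟩ = q ⟨j h, hj⟩) :
    ∃ (α' : A →* WreathProduct D S) (β' : B →* WreathProduct D S),
      α'.ker = p.ker.map α.ker.subtype ∧ β'.ker = q.ker.map β.ker.subtype ∧
      ∀ h, α' (i h) = β' (j h) := by
  obtain ⟨c, hc, hcp⟩ := exists_cocycle_extending α p hp
  obtain ⟨e, he, heq⟩ := exists_cocycle_extending β q hq
  obtain ⟨w, hw⟩ := exists_coboundary (α.comp i) (fun h s => c (i h) s * (e (j h) s)⁻¹)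
    (fun g h s => by
      simp only [map_mul, hc, he, MonoidHom.comp_apply, hαβ, mul_inv_rev]
      rw [mul_comm (e (j h) s)⁻¹, mul_mul_mul_comm])
    (fun h s (hh : α (i h) = 1) => by
      have hj : β (j h) = 1 := hαβ h ▸ hh
      have h1 := hcp ⟨i h, hh⟩ s
      have h2 := heq ⟨j h, hj⟩ s
      simp only at h1 h2
      rw [h1, h2, hpq h hh hj, mul_inv_cancel])
  have he' : ∀ a b s, w (β (a * b) * s) * e (a * b) s * (w s)⁻¹ =
      w (β a * (β b * s)) * e a (β b * s) * (w (β b * s))⁻¹ *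
        (w (β b * s) * e b s * (w s)⁻¹) := fun a b s => by
    rw [he, map_mul, mul_assoc (β a)]
    group
  refine ⟨wreathHomOfCocycle α c hc,
    wreathHomOfCocycle β (fun b s => w (β b * s) * e b s * (w s)⁻¹) he', ?_, ?_, fun h => ?_⟩
  · ext a
    rw [MonoidHom.mem_ker, wreathHomOfCocycle_ker]
    constructor
    · rintro ⟨ha, hs⟩
      exact ⟨⟨a, ha⟩, (hcp ⟨a, ha⟩ 1).symm.trans (hs 1), rfl⟩
    · rintro ⟨d, hd, rfl⟩
      exact ⟨d.2, fun s => (hcp d s).trans hd⟩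
  · ext b
    rw [MonoidHom.mem_ker, wreathHomOfCocycle_ker]
    constructor
    · rintro ⟨hb, hs⟩
      refine ⟨⟨b, hb⟩, (heq ⟨b, hb⟩ 1).symm.trans ?_, rfl⟩
      have h1 := hs 1
      rw [hb, one_mul, mul_inv_eq_one, mul_eq_left] at h1
      exact h1
    · rintro ⟨d, hd, rfl⟩
      refine ⟨d.2, fun s => ?_⟩
      have h1 : β d = 1 := d.2
      have h2 : e d s = 1 := (heq d s).trans hd
      simp [h1, h2]
  · ext s
    · change c (i h) ((α (i h))⁻¹ * s) = w (β (j h) * ((β (j h))⁻¹ * s)) *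
        e (j h) ((β (j h))⁻¹ * s) * (w ((β (j h))⁻¹ * s))⁻¹
      have h1 := hw h ((β (j h))⁻¹ * s)
      simp only [MonoidHom.comp_apply, hαβ] at h1 ⊢
      rw [h1]
      rw [mul_right_comm, mul_inv_cancel_right, inv_mul_cancel_right]
    · exact hαβ h

end Cocycles

section CentralSeries

variable {C : ∀ (G : Type u) [Group G], Prop}

theorem normal_of_commutator_mem {A : Type*} [Group A] {M N : Subgroup A} (hMN : M ≤ N)
    (h : ∀ x ∈ N, ∀ g : A, ⁅x, g⁆ ∈ M) : M.Normal where
  conj_mem x hx g := by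
    have h1 := M.mul_mem (M.inv_mem (h x (hMN hx) g)) hx
    simpa [commutatorElement_def, mul_assoc] using h1

/-- The map of a subgroup `N`, central modulo `M`, into the center of `A ⧸ M`. -/
def centralQuotientHom {A : Type*} [Group A] (M N : Subgroup A) [M.Normal]
    (h : ∀ x ∈ N, ∀ g : A, ⁅x, g⁆ ∈ M) : N →* Subgroup.center (A ⧸ M) :=
  ((QuotientGroup.mk' M).comp N.subtype).codRestrict _ fun x => by
    rw [Subgroup.mem_center_iff]
    intro g
    induction g using QuotientGroup.induction_on with
    | H g =>
      have h1 : QuotientGroup.mk' M ⁅(x : A), g⁆ = 1 := (QuotientGroup.eq_one_iff _).2 (h x x.2 g)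
      rw [map_commutatorElement, commutatorElement_eq_one_iff_mul_comm] at h1
      exact h1.symm

theorem centralQuotientHom_eq_one_iff {A : Type*} [Group A] (M N : Subgroup A) [M.Normal]
    (h : ∀ x ∈ N, ∀ g : A, ⁅x, g⁆ ∈ M) (x : N) :
    centralQuotientHom M N h x = 1 ↔ (x : A) ∈ M := by
  rw [Subtype.ext_iff]
  exact QuotientGroup.eq_one_iff (x : A)

theorem centralQuotientHom_conj {A : Type*} [Group A] (M N : Subgroup A) [M.Normal]
    (h : ∀ x ∈ N, ∀ g : A, ⁅x, g⁆ ∈ M) (a : A) (x y : N) (hxy : (y : A) = a⁻¹ * x * a) :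
    centralQuotientHom M N h y = centralQuotientHom M N h x := by
  refine Subtype.ext (QuotientGroup.eq.2 ?_)
  have h1 := M.inv_mem (h (x⁻¹ : N) (SetLike.coe_mem _) a⁻¹)
  simpa [hxy, commutatorElement_def, mul_assoc] using h1

open scoped IsMulCommutative in
/-- Two groups with central series compatible along a common source `H` map compatibly to a
single group in the class, with kernels the given terms of the series. -/
theorem exists_compatible_homs_of_centralSeries (hsub : SubgroupClosed C)
    (hprod : ProdClosed C) (hquot : QuotClosed C) (hwr : WreathClosed C)
    {A B H : Type u} [Group A] [Group B] [Group H] (hCA : C A) (hCB : C B)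
    (i : H →* A) (j : H →* B) (n : ℕ) (Aser : ℕ → Subgroup A) (Bser : ℕ → Subgroup B)
    (hAn : Aser n = ⊤) (hBn : Bser n = ⊤)
    (hAasc : ∀ k, Aser k ≤ Aser (k + 1)) (hBasc : ∀ k, Bser k ≤ Bser (k + 1))
    (hAcent : ∀ k, ∀ x ∈ Aser (k + 1), ∀ g : A, ⁅x, g⁆ ∈ Aser k)
    (hBcent : ∀ k, ∀ x ∈ Bser (k + 1), ∀ g : B, ⁅x, g⁆ ∈ Bser k)
    (hcompat : ∀ k ≤ n, ∀ h : H, i h ∈ Aser k ↔ j h ∈ Bser k) (k : ℕ) (hk : k ≤ n) :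
    ∃ (S : Type u) (_ : Group S), C S ∧ ∃ (α : A →* S) (β : B →* S),
      α.ker = Aser k ∧ β.ker = Bser k ∧ ∀ h, α (i h) = β (j h) := by
  induction hk using Nat.decreasingInduction with
  | self => exact ⟨(⊥ : Subgroup A), inferInstance, hsub _ _ hCA, 1, 1, by simp [hAn],
      by simp [hBn], fun _ => rfl⟩
  | of_succ k hk ih =>
    obtain ⟨S, _, hS, α, β, hα, hβ, hαβ⟩ := ih
    have hAnormal : (Aser k).Normal := normal_of_commutator_mem (hAasc k) (hAcent k)
    have hBnormal : (Bser k).Normal := normal_of_commutator_mem (hBasc k) (hBcent k)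
    let pA := centralQuotientHom (Aser k) α.ker (hα ▸ hAcent k)
    let pB := centralQuotientHom (Bser k) β.ker (hβ ▸ hBcent k)
    let H' : Subgroup H := α.ker.comap i
    have hH' : ∀ h ∈ H', j h ∈ β.ker := fun h hh => by
      rw [MonoidHom.mem_ker, ← hαβ]; exact hh
    let iH : H' →* α.ker := (i.comp H'.subtype).codRestrict α.ker fun h => h.2
    let jH : H' →* β.ker := (j.comp H'.subtype).codRestrict β.ker fun h => hH' h h.2
    let θ : H' →* Subgroup.center (A ⧸ Aser k) × Subgroup.center (B ⧸ Bser k) :=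
      (pA.comp iH).prod (pB.comp jH)⁻¹
    let D := (Subgroup.center (A ⧸ Aser k) × Subgroup.center (B ⧸ Bser k)) ⧸ θ.range
    let mk : Subgroup.center (A ⧸ Aser k) × Subgroup.center (B ⧸ Bser k) →* D :=
      QuotientGroup.mk' θ.range
    have hCD : C D := hquot _ _ (hprod _ _ (hsub _ _ (hquot _ _ hCA)) (hsub _ _ (hquot _ _ hCB)))
    let p : α.ker →* D := (mk.comp (MonoidHom.inl _ _)).comp pA
    let q : β.ker →* D := (mk.comp (MonoidHom.inr _ _)).comp pB
    have hmk : ∀ z, mk z = 1 ↔ z ∈ θ.range := fun z => QuotientGroup.eq_one_iff z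
    have hpker : ∀ d, p d = 1 ↔ (d : A) ∈ Aser k := by
      intro d
      rw [← centralQuotientHom_eq_one_iff (Aser k) α.ker (hα ▸ hAcent k)]
      refine ⟨fun h => ?_,
        fun h => (congrArg (mk.comp (MonoidHom.inl _ _)) h).trans (map_one _)⟩
      obtain ⟨h, hh⟩ := (hmk _).1 h
      have h1 : pA (iH h) = pA d := congrArg Prod.fst hh
      have h2 : (pB (jH h))⁻¹ = 1 := congrArg Prod.snd hh
      rw [inv_eq_one, centralQuotientHom_eq_one_iff] at h2
      rw [← h1, centralQuotientHom_eq_one_iff]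
      exact (hcompat k hk.le h).2 h2
    have hqker : ∀ d, q d = 1 ↔ (d : B) ∈ Bser k := by
      intro d
      rw [← centralQuotientHom_eq_one_iff (Bser k) β.ker (hβ ▸ hBcent k)]
      refine ⟨fun h => ?_,
        fun h => (congrArg (mk.comp (MonoidHom.inr _ _)) h).trans (map_one _)⟩
      obtain ⟨h, hh⟩ := (hmk _).1 h
      have h1 : (pB (jH h))⁻¹ = pB d := congrArg Prod.snd hh
      have h2 : pA (iH h) = 1 := congrArg Prod.fst hh
      rw [centralQuotientHom_eq_one_iff] at h2
      rw [← h1, inv_eq_one, centralQuotientHom_eq_one_iff]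
      exact (hcompat k hk.le h).1 h2
    obtain ⟨α', β', hα', hβ', hαβ'⟩ := exists_compatible_wreath_homs i j α β hαβ p q
      (fun a d e h => congrArg (mk.comp (MonoidHom.inl _ _))
        (centralQuotientHom_conj (Aser k) α.ker (hα ▸ hAcent k) a d e h))
      (fun b d e h => congrArg (mk.comp (MonoidHom.inr _ _))
        (centralQuotientHom_conj (Bser k) β.ker (hβ ▸ hBcent k) b d e h))
      (fun h hi hj => by
        refine (QuotientGroup.eq_iff_div_mem).2 ⟨⟨h, hi⟩, ?_⟩
        exact Prod.ext (div_one _).symm (one_div _).symm)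
    refine ⟨WreathProduct D S, inferInstance, hwr _ _ hCD hS, α', β', ?_, ?_, hαβ'⟩
    · ext a
      rw [hα']
      constructor
      · rintro ⟨d, hd, rfl⟩
        exact (hpker d).1 hd
      · intro ha
        exact ⟨⟨a, hα ▸ hAasc k ha⟩, (hpker _).2 ha, rfl⟩
    · ext b
      rw [hβ']
      constructor
      · rintro ⟨d, hd, rfl⟩
        exact (hqker d).1 hd
      · intro hb
        exact ⟨⟨b, hβ ▸ hBasc k hb⟩, (hqker _).2 hb, rfl⟩

end CentralSeries

section Residual

open Monoid.PushoutI

variable {ι : Type*} {G : ι → Type*} {H : Type*} [∀ i, Group (G i)] [Group H]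
  {φ : ∀ i, H →* G i} {S R : Type u} [Group S] [Group R]

/-- The homomorphism of a pushout to a wreath product obtained from `f` by conjugating its
restriction to the `i`-th factor by a function `w i`. -/
def twistedWreathHom (f : PushoutI φ →* S) (w : ι → S → R)
    (hw : ∀ i h s, w i (f (base φ h) * s) = w i s) : PushoutI φ →* WreathProduct R S :=
  lift (fun i => (MulAut.conj (inl (w i))).toMonoidHom.comp (inr.comp (f.comp (of i))))
    (inr.comp (f.comp (base φ))) fun i => by
      ext h s
      · have hinv : w i ((f (base φ h))⁻¹ * s) = w i s := by
          rw [← hw i h ((f (base φ h))⁻¹ * s), mul_inv_cancel_left]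
        simp [-map_inv, of_apply_eq_base, wreathAut_apply_apply, hinv]
      · simp [of_apply_eq_base]

variable (f : PushoutI φ →* S) (w : ι → S → R)
  (hw : ∀ i h s, w i (f (base φ h) * s) = w i s)

theorem twistedWreathHom_right (g : PushoutI φ) : (twistedWreathHom f w hw g).right = f g := by
  suffices rightHom.comp (twistedWreathHom f w hw) = f from DFunLike.congr_fun this g
  refine hom_ext (fun i => ?_) ?_ <;> ext <;> simp [twistedWreathHom]

theorem twistedWreathHom_of_mul_left (i : ι) (x : G i) (g : PushoutI φ) :
    (twistedWreathHom f w hw (of i x * g)).left (f (of i x * g)) =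
      w i (f (of i x * g)) * (w i (f g))⁻¹ * (twistedWreathHom f w hw g).left (f g) := by
  have h : twistedWreathHom f w hw (of i x) = inl (w i) * inr (f (of i x)) * (inl (w i))⁻¹ := by
    simp [twistedWreathHom]
  rw [map_mul, h]
  simp [-map_inv, wreathAut_apply_apply]

theorem twistedWreathHom_base_mul_left (h : H) (g : PushoutI φ) :
    (twistedWreathHom f w hw (base φ h * g)).left (f (base φ h * g)) =
      (twistedWreathHom f w hw g).left (f g) := by
  have h' : twistedWreathHom f w hw (base φ h) = inr (f (base φ h)) := by
    simp [twistedWreathHom]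
  rw [map_mul, h']
  simp [-map_inv, wreathAut_apply_apply]

/-- The element of the pushout spelled by a list of letters. -/
def letterProd (φ : ∀ i, H →* G i) (l : List (Σ i, G i)) : PushoutI φ :=
  (l.map fun x => of x.1 x.2).prod

@[simp]
theorem letterProd_cons (x : Σ i, G i) (l : List (Σ i, G i)) :
    letterProd φ (x :: l) = of x.1 x.2 * letterProd φ l := by simp [letterProd]

/-- In a suitable wreath-closed image, a reduced word lies outside the base cosets of all its
proper suffixes. -/
theorem exists_hom_separating_suffixes {C : ∀ (G : Type u) [Group G], Prop}
    (hwr : WreathClosed C) {R : Type u} [Group R] [Nontrivial R] (hR : C R)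
    {S₀ : Type u} [Group S₀] (hS₀ : C S₀) (f₀ : PushoutI φ →* S₀)
    (hf₀ : ∀ i, Function.Injective (f₀.comp (of i))) (l : List (Σ i, G i))
    (hl : l.IsChain fun x y => x.1 ≠ y.1) (hbase : ∀ x ∈ l, x.2 ∉ (φ x.1).range) :
    ∃ (S : Type u) (_ : Group S), C S ∧ ∃ f : PushoutI φ →* S,
      (∀ i, Function.Injective (f.comp (of i))) ∧
      ∀ t, t <:+ l → t ≠ l → ∀ h, f (letterProd φ l) ≠ f (base φ h * letterProd φ t) := by
  classical
  induction l with
  | nil => exact ⟨S₀, _, hS₀, f₀, hf₀, fun t ht hne => absurd (List.suffix_nil.1 ht) hne⟩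
  | cons x l ih =>
    obtain ⟨S, _, hS, f, hf, hsep⟩ :=
      ih hl.tail fun y hy => hbase y (List.mem_cons_of_mem _ hy)
    obtain ⟨r, hr⟩ := exists_ne (1 : R)
    let E : Subgroup S := (f.comp (base φ)).range
    let w : ι → S → R := fun i s =>
      if i = x.1 ∧ s * (f (letterProd φ l))⁻¹ ∈ E then r else 1
    have hw : ∀ i h s, w i (f (base φ h) * s) = w i s := fun i h s => by
      have : f (base φ h) ∈ E := ⟨h, rfl⟩
      simp only [w, mul_assoc, E.mul_mem_cancel_left this]
    let F := twistedWreathHom f w hw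
    have hw_suffix : ∀ t, t <:+ l → t ≠ l → ∀ i, w i (f (letterProd φ t)) = 1 := by
      intro t ht hne i
      refine if_neg fun ⟨_, h, hh⟩ => hsep t ht hne h⁻¹ ?_
      rw [MonoidHom.comp_apply, eq_mul_inv_iff_mul_eq] at hh
      rw [map_mul, ← hh, map_inv, map_inv, inv_mul_cancel_left]
    have hF_suffix : ∀ t, t <:+ l → (F (letterProd φ t)).left (f (letterProd φ t)) = 1 := by
      intro t
      induction t with
      | nil => intro _; simp [letterProd]
      | cons y t iht =>
        intro ht
        have ht' : t <:+ l := (List.suffix_cons y t).trans ht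
        rw [letterProd_cons, twistedWreathHom_of_mul_left, iht ht', mul_one, ← letterProd_cons]
        by_cases hy : y.1 = x.1
        · have h1 : y :: t ≠ l := by
            rintro rfl
            exact (List.isChain_cons_cons.1 hl).1 hy.symm
          have h2 : t ≠ l := by
            rintro rfl
            simpa using ht.length_le
          rw [hw_suffix _ ht h1, hw_suffix _ ht' h2, mul_inv_cancel]
        · simp [w, hy]
    have hx : w x.1 (f (letterProd φ (x :: l))) = 1 := by
      refine if_neg fun ⟨_, h, hh⟩ => hbase x List.mem_cons_self ⟨h, hf x.1 ?_⟩
      rw [letterProd_cons, map_mul, mul_inv_cancel_right] at hh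
      simpa [of_apply_eq_base] using hh
    have hl1 : w x.1 (f (letterProd φ l)) = r := if_pos ⟨rfl, by simp⟩
    have hF_ne : (F (letterProd φ (x :: l))).left (f (letterProd φ (x :: l))) ≠ 1 := by
      rw [letterProd_cons, twistedWreathHom_of_mul_left, hF_suffix l List.suffix_rfl, mul_one,
        ← letterProd_cons, hx, hl1, one_mul]
      exact inv_ne_one.2 hr
    refine ⟨WreathProduct R S, inferInstance, hwr _ _ hR hS, F, fun i a b hab => hf i ?_,
      fun t ht hne h hF => hF_ne ?_⟩
    · have h1 := congrArg SemidirectProduct.right hab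
      simpa only [F, MonoidHom.comp_apply, twistedWreathHom_right] using h1
    · have hf' : f (letterProd φ (x :: l)) = f (base φ h * letterProd φ t) := by
        have h1 := congrArg SemidirectProduct.right hF
        simpa only [F, twistedWreathHom_right] using h1
      rw [hF, hf', twistedWreathHom_base_mul_left]
      exact hF_suffix t ((List.suffix_cons_iff.1 ht).resolve_left hne)

/-- A pushout of groups admitting a homomorphism to a `C`-group injective on the factors is
residually a `C`-group. -/
theorem exists_hom_ne_one {C : ∀ (G : Type u) [Group G], Prop}
    (hwr : WreathClosed C) {R : Type u} [Group R] [Nontrivial R] (hR : C R)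
    {S₀ : Type u} [Group S₀] (hS₀ : C S₀) (hφ : ∀ i, Function.Injective (φ i)) [Nonempty ι]
    (f₀ : PushoutI φ →* S₀) (hf₀ : ∀ i, Function.Injective (f₀.comp (of i)))
    (g : PushoutI φ) (hg : g ≠ 1) :
    ∃ (S : Type u) (_ : Group S), C S ∧ ∃ f : PushoutI φ →* S, f g ≠ 1 := by
  classical
  obtain ⟨d⟩ := NormalWord.transversal_nonempty φ hφ
  let v : NormalWord d := NormalWord.equiv g
  have hv : base φ v.head * letterProd φ v.toList = g := by
    have h1 : v.prod = g := NormalWord.equiv.symm_apply_apply g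
    rw [← h1, NormalWord.prod, CoprodI.Word.prod, map_list_prod, List.map_map]
    simp [letterProd, Function.comp_def]
  have hbase : ∀ x ∈ v.toList, x.2 ∉ (φ x.1).range := by
    rintro ⟨i, x⟩ hx hmem
    refine v.ne_one _ hx ?_
    have h1 := (d.compl i).1
    have h2 := @h1 (⟨x, hmem⟩, ⟨1, d.one_mem i⟩) (1, ⟨x, v.normalized i x hx⟩) (by simp)
    simpa using congrArg (fun z => (z.1 : G i)) h2
  obtain ⟨S, _, hS, f, hf, hsep⟩ :=
    exists_hom_separating_suffixes hwr hR hS₀ f₀ hf₀ v.toList v.chain_ne hbase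
  refine ⟨S, _, hS, f, fun hfg => ?_⟩
  by_cases hnil : v.toList = []
  · rw [hnil] at hv
    obtain ⟨i⟩ := ‹Nonempty ι›
    have h1 : of i (φ i v.head) = g := by simpa [letterProd, of_apply_eq_base] using hv
    have h2 : φ i v.head = 1 := hf i (by simp [h1, hfg])
    exact hg (by rw [← h1, h2, map_one])
  · refine hsep [] List.nil_suffix (Ne.symm hnil) v.head⁻¹ ?_
    rw [← hv, map_mul] at hfg
    rw [eq_inv_of_mul_eq_one_right hfg]
    simp [letterProd]

end Residual

/-- **Theorem 2.** Let `C` be a nontrivial root class of groups closed under taking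
quotient groups, and let `G = ⟨A * B; H = K, φ⟩` be the free product of nilpotent
`C`-groups `A` and `B` with subgroups `H ≤ A` and `K ≤ B` amalgamated according to an
isomorphism `φ`. If `A` and `B` possess central series of the same length `n`,
`1 = A₀ ≤ A₁ ≤ … ≤ Aₙ = A` and `1 = B₀ ≤ B₁ ≤ … ≤ Bₙ = B`, such that
`φ(Aᵢ ∩ H) = Bᵢ ∩ K` for every `i ∈ {1, …, n}`, then there is a homomorphism of `G` onto
a solvable `C`-group which is injective on `A` and on `B`; in particular, `G` is
residually a (solvable `C`)-group. -/
theorem amalgam_of_nilpotent_residually_solvable (C : ∀ (G : Type u) [Group G], Prop)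
    (hC : RootClass C) (hquot : QuotClosed C)
    (hnontriv : ∃ (G : Type u) (hG : Group G), letI := hG; (C G ∧ Nontrivial G))
    (A B : Type u) [Group A] [Group B]
    (hCA : C A) (hCB : C B)
    (hnilA : Group.IsNilpotent A) (hnilB : Group.IsNilpotent B)
    (H : Subgroup A) (K : Subgroup B) (φ : H ≃* K)
    (n : ℕ) (Aser : ℕ → Subgroup A) (Bser : ℕ → Subgroup B)
    (hA0 : Aser 0 = ⊥) (hAn : Aser n = ⊤)
    (hB0 : Bser 0 = ⊥) (hBn : Bser n = ⊤)
    (hAasc : ∀ i, Aser i ≤ Aser (i + 1)) (hBasc : ∀ i, Bser i ≤ Bser (i + 1))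
    (hAcent : ∀ i, ∀ x ∈ Aser (i + 1), ∀ g : A, ⁅x, g⁆ ∈ Aser i)
    (hBcent : ∀ i, ∀ x ∈ Bser (i + 1), ∀ g : B, ⁅x, g⁆ ∈ Bser i)
    (hcompat : ∀ i, 1 ≤ i → i ≤ n →
      ∀ h : H, ((h : A) ∈ Aser i ↔ ((φ h : K) : B) ∈ Bser i)) :
    (∃ (S : Type u) (hS : Group S), letI := hS;
      (C S ∧ IsSolvable S ∧
        ∃ f : AmalgamatedProduct A B H K φ →* S, Function.Surjective f ∧
          Function.Injective (f.comp (amalgInl H K φ)) ∧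
          Function.Injective (f.comp (amalgInr H K φ)))) ∧
    (∀ g : AmalgamatedProduct A B H K φ, g ≠ 1 →
      ∃ (S : Type u) (hS : Group S), letI := hS;
        (C S ∧ IsSolvable S ∧
          ∃ f : AmalgamatedProduct A B H K φ →* S, Function.Surjective f ∧ f g ≠ 1)) := by
  obtain ⟨-, hsub, hprod, -⟩ := id hC
  have hwr := hC.wreathClosed
  let CS : ∀ (G : Type u) [Group G], Prop := fun G _ => C G ∧ Group.IsSolvable G
  have hCS_sub : SubgroupClosed CS := fun G _ L h =>
    have := h.2
    ⟨hsub G L h.1, inferInstance⟩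
  have hCS_prod : ProdClosed CS := fun X Y _ _ hX hY =>
    have := hX.2
    have := hY.2
    ⟨hprod X Y hX.1 hY.1, inferInstance⟩
  have hCS_quot : QuotClosed CS := fun G _ N _ h =>
    have := h.2
    ⟨hquot G N h.1, inferInstance⟩
  have hCS_wr : WreathClosed CS := fun X Y _ _ hX hY =>
    have := hX.2
    have := hY.2
    ⟨hwr X Y hX.1 hY.1, isSolvable_wreathProduct X Y⟩
  have hCS_A : CS A := ⟨hCA, inferInstance⟩
  have hCS_B : CS B := ⟨hCB, inferInstance⟩
  obtain ⟨S, _, hS, α, β, hα, hβ, hαβ⟩ := exists_compatible_homs_of_centralSeries hCS_sub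
    hCS_prod hCS_quot hCS_wr hCS_A hCS_B H.subtype (K.subtype.comp φ.toMonoidHom) n Aser Bser
    hAn hBn hAasc hBasc hAcent hBcent
    (fun k hk h => by
      rcases k.eq_zero_or_pos with rfl | hpos
      · simp [hA0, hB0]
      · exact hcompat k hpos hk h) 0 n.zero_le
  rw [hA0, MonoidHom.ker_eq_bot_iff] at hα
  rw [hB0, MonoidHom.ker_eq_bot_iff] at hβ
  let f : AmalgamatedProduct A B H K φ →* S :=
    PushoutI.lift (φ := amalgMaps H K φ) (fun | true => α | false => β) (α.comp H.subtype) (by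
      rintro (_ | _)
      · ext h
        exact (hαβ h).symm
      · rfl)
  have hfl : ∀ a, f (amalgInl H K φ a) = α a := fun a =>
    PushoutI.lift_of (φ := amalgMaps H K φ) _ _ _ (i := true) a
  have hfr : ∀ b, f (amalgInr H K φ b) = β b := fun b =>
    PushoutI.lift_of (φ := amalgMaps H K φ) _ _ _ (i := false) b
  refine ⟨⟨f.range, inferInstance, (hCS_sub _ _ hS).1, (hCS_sub _ _ hS).2, f.rangeRestrict,
    f.rangeRestrict_surjective, fun a b hab => hα ?_, fun a b hab => hβ ?_⟩, fun g hg => ?_⟩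
  · exact (hfl a).symm.trans ((congrArg Subtype.val hab).trans (hfl b))
  · exact (hfr a).symm.trans ((congrArg Subtype.val hab).trans (hfr b))
  · obtain ⟨R, _, hR, _⟩ := hnontriv
    obtain ⟨r, hr⟩ := exists_ne (1 : R)
    have hr_nontriv : Nontrivial (Subgroup.zpowers r) :=
      (Subgroup.nontrivial_iff_ne_bot _).2 (Subgroup.zpowers_ne_bot.2 hr)
    have hCS_r : CS (Subgroup.zpowers r) :=
      ⟨hsub _ _ hR, Group.isSolvable_of_comm fun a b => mul_comm' a b⟩
    obtain ⟨T, _, hT, F, hF⟩ := exists_hom_ne_one hCS_wr hCS_r hS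
      (φ := amalgMaps H K φ) (by
        rintro (_ | _)
        · exact K.subtype_injective.comp φ.injective
        · exact H.subtype_injective) f (by
        rintro (_ | _)
        · exact fun a b hab => hβ ((hfr a).symm.trans (hab.trans (hfr b)))
        · exact fun a b hab => hα ((hfl a).symm.trans (hab.trans (hfl b)))) g hg
    exact ⟨F.range, inferInstance, (hCS_sub _ _ hT).1, (hCS_sub _ _ hT).2, F.rangeRestrict,
      F.rangeRestrict_surjective, fun h => hF (congrArg Subtype.val h)⟩
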